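/- For the full perturbation V_main = V₁ + V₂, the second-order effective interaction on the encoded qubits satisfies −E† V_main G V_main E = −(10/9)·I₄ + (4/9)(X⊗X + Z⊗Z), for any matrix G with G = Π₊ G Π₊ and G·(Π_c H₀ Π_c)·Π₊ = Π₊. -/

import Mathlib

open Matrix
open scoped Kronecker

noncomputable section

/-- Index type for the Fock space of 9 fermionic modes, `ℂ^512`.
Modes `i1,i2,i3,j1,j2,j3,x,y,z` are labelled `0,…,8` in this order. -/
abbrev Idx := Fin 9 → Bool

abbrev Mat := Matrix Idx Idx ℂ

/-- Jordan–Wigner annihilation operator `a_k = Z^{⊗(k-1)} ⊗ σ⁻ ⊗ I^{⊗(9-k)}`,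
written entrywise in the occupation-number basis (`false` = unoccupied `|0⟩`). -/
def a (k : Fin 9) : Mat :=
  Matrix.of fun s t =>
    if t k = true ∧ s = Function.update t k false then
      (-1 : ℂ) ^ (Finset.univ.filter fun l => l < k ∧ t l = true).card
    else 0

/-- Creation operator `a_k†`. -/
def ad (k : Fin 9) : Mat := (a k)ᴴ

/-- The vacuum state `|vac⟩ = |0⟩^{⊗9}`. -/
def vac : Idx → ℂ := fun t => if t = (fun _ => false) then 1 else 0

/-- `√3` as a complex number. -/
def s3 : ℂ := (Real.sqrt 3 : ℝ)

/-- The edges of the constraint graph `G_c`: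
`{i1,i2},{i2,i3},{i1,i3},{j1,j2},{j2,j3},{j1,j3},{i2,x},{j2,x},{i3,y},{j3,y},{i1,z},{j1,z}`. -/
def edges : Finset (Fin 9 × Fin 9) :=
  {(0,1), (1,2), (0,2), (3,4), (4,5), (3,5), (1,6), (4,6), (2,7), (5,7), (0,8), (3,8)}

/-- Adjacency in the constraint graph `G_c`. -/
def Adj (k l : Fin 9) : Prop := (k, l) ∈ edges ∨ (l, k) ∈ edges

instance (k l : Fin 9) : Decidable (Adj k l) := by unfold Adj; infer_instance

/-- `S` is an independent set of the constraint graph `G_c`. -/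
def IndepSet (S : Finset (Fin 9)) : Prop := ∀ k ∈ S, ∀ l ∈ S, ¬ Adj k l

instance (S : Finset (Fin 9)) : Decidable (IndepSet S) := by unfold IndepSet; infer_instance

/-- The Fock basis state `|S⟩` with exactly the modes in `S` occupied. -/
def fock (S : Finset (Fin 9)) : Idx → ℂ :=
  fun t => if t = (fun k => decide (k ∈ S)) then 1 else 0

/-- The set of occupied modes of an occupation vector. -/
def suppOf (t : Idx) : Finset (Fin 9) := Finset.univ.filter fun k => t k = true

/-- The two-particle constrained subspace: the span of the Fock states `|S⟩` over
independent sets `S` of `G_c` with `|S| = 2`. -/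
def C2 : Submodule ℂ (Idx → ℂ) :=
  Submodule.span ℂ {v | ∃ S : Finset (Fin 9), IndepSet S ∧ S.card = 2 ∧ v = fock S}

/-- `Π_c`, the orthogonal projector onto the two-particle constrained subspace.
Since that subspace is spanned by standard (Fock) basis vectors, the orthogonal
projector is the diagonal 0/1 matrix supported on those coordinates. -/
def Pic : Mat :=
  Matrix.diagonal fun t => if IndepSet (suppOf t) ∧ (suppOf t).card = 2 then 1 else 0

/-- `H_{0,i} = I + (a_{i1}†a_{i2}+h.c.) + (a_{i2}†a_{i3}+h.c.) + (a_{i3}†a_{i1}+h.c.)`. -/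
def H0i : Mat :=
  1 + (ad 0 * a 1 + ad 1 * a 0) + (ad 1 * a 2 + ad 2 * a 1) + (ad 2 * a 0 + ad 0 * a 2)

/-- `H_{0,j}`, defined analogously on modes `j1,j2,j3`. -/
def H0j : Mat :=
  1 + (ad 3 * a 4 + ad 4 * a 3) + (ad 4 * a 5 + ad 5 * a 4) + (ad 5 * a 3 + ad 3 * a 5)

/-- `H₀ = H_{0,i} + H_{0,j}`. -/
def H0 : Mat := H0i + H0j

/-- `S_{·,b}` on modes `k1,k2,k3`:
`S_{·,0} = (1/(2√3))((1−√3)a_{k3}† − 2a_{k1}† + (1+√3)a_{k2}†)` and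
`S_{·,1} = (1/(2√3))((1+√3)a_{k3}† − 2a_{k1}† + (1−√3)a_{k2}†)`. -/
def Senc (k1 k2 k3 : Fin 9) (b : Fin 2) : Mat :=
  if b = 0 then
    (1 / (2 * s3)) • ((1 - s3) • ad k3 - (2 : ℂ) • ad k1 + (1 + s3) • ad k2)
  else
    (1 / (2 * s3)) • ((1 + s3) • ad k3 - (2 : ℂ) • ad k1 + (1 - s3) • ad k2)

/-- The encoded two-qubit state `|bb'⟩_enc = S_{i,b} S_{j,b'} |vac⟩`. -/
def enc (b b' : Fin 2) : Idx → ℂ := (Senc 0 1 2 b * Senc 3 4 5 b').mulVec vac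

/-- The encoding isometry `E : ℂ⁴ → ℂ^512`, sending `|b⟩⊗|b'⟩` to `|bb'⟩_enc`. -/
def Eenc : Matrix Idx (Fin 2 × Fin 2) ℂ := Matrix.of fun t p => enc p.1 p.2 t

/-- `Π₋ = E E†`, the orthogonal projector onto the span of the four encoded states. -/
def Pim : Mat := Eenc * Eencᴴ

/-- `Π₊ = Π_c − Π₋`. -/
def Pip : Mat := Pic - Pim

/-- `V₁ = (a_{i2}†a_x+h.c.) + (a_{j2}†a_x+h.c.) + (a_{i3}†a_y+h.c.) + (a_{j3}†a_y+h.c.)`. -/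
def V1 : Mat :=
  (ad 1 * a 6 + ad 6 * a 1) + (ad 4 * a 6 + ad 6 * a 4)
    + (ad 2 * a 7 + ad 7 * a 2) + (ad 5 * a 7 + ad 7 * a 5)

/-- `V₂ = (a_{i1}†a_z+h.c.) + (a_{j1}†a_z+h.c.)`. -/
def V2 : Mat := (ad 0 * a 8 + ad 8 * a 0) + (ad 3 * a 8 + ad 8 * a 3)

/-- `V_main = V₁ + V₂`. -/
def Vmain : Mat := V1 + V2

/-- The Pauli matrix `X`. -/
def PX : Matrix (Fin 2) (Fin 2) ℂ := !![0, 1; 1, 0]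

/-- The Pauli matrix `Z`. -/
def PZ : Matrix (Fin 2) (Fin 2) ℂ := !![1, 0; 0, -1]

/-- The Fock basis state with occupation numbers `t`. -/
def occ (t : Idx) : Idx → ℂ := Pi.single t 1

/-- The Jordan–Wigner sign of mode `k` in the occupation state `t`. -/
def jwSign (k : Fin 9) (t : Idx) : ℂ :=
  (-1 : ℂ) ^ (Finset.univ.filter fun l => l < k ∧ t l = true).card

lemma jwSign_mul_self (k : Fin 9) (t : Idx) : jwSign k t * jwSign k t = 1 := by
  rw [jwSign, ← mul_pow]; norm_num

lemma jwSign_update_true (k q : Fin 9) (t : Idx) :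
    jwSign k (Function.update t q true) =
      (if q < k then -1 else 1) * jwSign k (Function.update t q false) := by
  unfold jwSign
  split_ifs with h
  · have : (Finset.univ.filter fun l => l < k ∧ Function.update t q true l = true) =
        insert q (Finset.univ.filter fun l => l < k ∧ Function.update t q false l = true) := by
      ext l
      by_cases hl : l = q
      · subst hl; simp [h]
      · simp [hl]
    rw [this, Finset.card_insert_of_notMem (by simp), pow_succ']
  · rw [one_mul]
    congr 2
    ext l
    by_cases hl : l = q
    · subst hl; simp [h]
    · simp [hl]

lemma jwSign_update_self (k : Fin 9) (b : Bool) (t : Idx) :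
    jwSign k (Function.update t k b) = jwSign k t := by
  unfold jwSign
  congr 2
  ext l
  by_cases hl : l = k
  · subst hl; simp
  · simp [hl]

lemma a_mulVec_occ (k : Fin 9) (t : Idx) :
    a k *ᵥ occ t =
      if t k = true then jwSign k t • occ (Function.update t k false) else 0 := by
  ext s
  rw [occ, Matrix.mulVec_single_one]
  by_cases h : t k = true <;> simp [a, h, jwSign, occ, Pi.single_apply, Matrix.col]

lemma ad_mulVec_occ (k : Fin 9) (t : Idx) :
    ad k *ᵥ occ t =
      if t k = true then 0 else jwSign k t • occ (Function.update t k true) := by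
  ext s
  rw [occ, Matrix.mulVec_single_one]
  have key : (s k = true ∧ t = Function.update s k false) ↔
      (t k = false ∧ s = Function.update t k true) := by
    constructor
    · rintro ⟨h, rfl⟩; simp [← h]
    · rintro ⟨h, rfl⟩; simp [← h]
  simp only [Matrix.col_apply, ad, Matrix.conjTranspose_apply, a, Matrix.of_apply, key]
  by_cases h : t k = true
  · simp [h]
  · rw [Bool.not_eq_true] at h
    by_cases hs : s = Function.update t k true
    · subst hs
      have := jwSign_update_self k true t
      unfold jwSign at this
      simp only [h, true_and, if_true, this]
      simp [jwSign, occ]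
    · simp [h, hs, occ]

lemma a_mul_ad_add (q k : Fin 9) :
    a q * ad k + ad k * a q = if q = k then 1 else 0 := by
  refine Matrix.ext_of_mulVec_single fun t => ?_
  change _ *ᵥ occ t = _ *ᵥ occ t
  rw [Matrix.add_mulVec, ← Matrix.mulVec_mulVec, ← Matrix.mulVec_mulVec, ad_mulVec_occ,
    a_mulVec_occ]
  by_cases hqk : q = k
  · subst hqk
    by_cases h : t q = true
    · have hu : Function.update t q true = t := by rw [← h]; simp
      simp [h, Matrix.mulVec_smul, ad_mulVec_occ, smul_smul, jwSign_update_self,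
        jwSign_mul_self, hu]
    · have hu : Function.update t q false = t := by
        rw [Bool.not_eq_true] at h; rw [← h]; simp
      simp [h, Matrix.mulVec_smul, a_mulVec_occ, smul_smul, jwSign_update_self,
        jwSign_mul_self, hu]
  · by_cases hk : t k = true
    · by_cases hq : t q = true <;>
        simp [hk, hq, hqk, Ne.symm hqk, Matrix.mulVec_smul, ad_mulVec_occ]
    · by_cases hq : t q = true
      · have h1 := jwSign_update_true q k t
        have h2 := jwSign_update_true k q t
        rw [Bool.not_eq_true] at hk
        have u1 : Function.update t k false = t := by rw [← hk]; simp
        have u2 : Function.update t q true = t := by rw [← hq]; simp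
        rw [u1] at h1
        rw [u2] at h2
        simp only [hk, hq, hqk, Ne.symm hqk, Matrix.mulVec_smul, ad_mulVec_occ,
          a_mulVec_occ, smul_smul, h1, h2, Function.update_of_ne, ne_eq, not_false_eq_true,
          Function.update_comm hqk, if_true, if_false, Bool.false_eq_true, Matrix.zero_mulVec,
          ← add_smul]
        convert zero_smul ℂ _
        rcases lt_or_gt_of_ne hqk with h | h
        · simp [h, h.not_gt]; ring
        · simp [h, h.not_gt]; ring
      · simp [hk, hq, hqk, Matrix.mulVec_smul, a_mulVec_occ]

lemma vac_eq_occ : vac = occ (fun _ => false) := by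
  ext t; simp [vac, occ, Pi.single_apply]

lemma a_mulVec_vac (k : Fin 9) : a k *ᵥ vac = 0 := by
  simp [vac_eq_occ, a_mulVec_occ]

/-- The two-particle state `a_k† a_l† |vac⟩`. -/
def ket (k l : Fin 9) : Idx → ℂ := ad k *ᵥ (ad l *ᵥ vac)

lemma a_mulVec_ad_mulVec (q k : Fin 9) (v : Idx → ℂ) :
    a q *ᵥ (ad k *ᵥ v) = (if q = k then v else 0) - ad k *ᵥ (a q *ᵥ v) := by
  have h := congrArg (· *ᵥ v) (a_mul_ad_add q k)
  simp only [Matrix.add_mulVec, ← Matrix.mulVec_mulVec] at h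
  rw [eq_sub_iff_add_eq, h]
  split_ifs <;> simp

lemma a_mulVec_ket (q k l : Fin 9) :
    a q *ᵥ ket k l =
      (if q = k then ad l *ᵥ vac else 0) - (if q = l then ad k *ᵥ vac else 0) := by
  rw [ket, a_mulVec_ad_mulVec, a_mulVec_ad_mulVec, a_mulVec_vac]
  split_ifs <;> simp

lemma ket_eq_smul_occ (k l : Fin 9) (h : k ≠ l) :
    ket k l = jwSign k (Function.update (fun _ => false) l true) •
      occ (Function.update (Function.update (fun _ => false) l true) k true) := by
  have : jwSign l (fun _ => false) = 1 := by simp [jwSign]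
  simp [ket, vac_eq_occ, ad_mulVec_occ, this, h]

lemma ket_self (k : Fin 9) : ket k k = 0 := by
  simp [ket, vac_eq_occ, ad_mulVec_occ, Matrix.mulVec_smul]

lemma ket_comm (k l : Fin 9) : ket l k = -ket k l := by
  rcases eq_or_ne k l with rfl | h
  · simp [ket_self]
  · have h1 := jwSign_update_true k l (fun _ => false)
    have h2 := jwSign_update_true l k (fun _ => false)
    have u (k : Fin 9) : Function.update (fun _ => false : Idx) k false = fun _ => false := by
      ext; simp [Function.update_apply]
    have e (k : Fin 9) : jwSign k (fun _ => false) = 1 := by simp [jwSign]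
    rw [u, e] at h1 h2
    rw [ket_eq_smul_occ k l h, ket_eq_smul_occ l k h.symm, Function.update_comm h, h1, h2]
    rcases lt_or_gt_of_ne h with h | h <;> simp [h, h.not_gt]

lemma hop_mulVec_ket (p q k l : Fin 9) :
    (ad p * a q) *ᵥ ket k l = (if q = k then ket p l else 0) + if q = l then ket k p else 0 := by
  rw [← Matrix.mulVec_mulVec, a_mulVec_ket, Matrix.mulVec_sub]
  rw [ket_comm p k]
  split_ifs <;> simp [-Matrix.mulVec_mulVec, ket, sub_eq_add_neg]

lemma Pic_mulVec_ket (k l : Fin 9) (h : k ≠ l) :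
    Pic *ᵥ ket k l = if IndepSet {k, l} then ket k l else 0 := by
  have hs : suppOf (Function.update (Function.update (fun _ => false) l true) k true) =
      {k, l} := by
    ext m
    by_cases hk : m = k <;> by_cases hl : m = l <;>
      simp [suppOf, Function.update_apply, hk, hl]
  have hc : ({k, l} : Finset (Fin 9)).card = 2 := Finset.card_pair h
  rw [ket_eq_smul_occ k l h, Matrix.mulVec_smul, Pic, occ, Matrix.diagonal_mulVec_single, hs, hc]
  split_ifs <;> simp_all

lemma star_ket_dotProduct_ket (k l m n : Fin 9) :
    star (ket k l) ⬝ᵥ ket m n =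
      (if k = m then if l = n then 1 else 0 else 0) -
        if k = n then if l = m then 1 else 0 else 0 := by
  have hv : star vac ⬝ᵥ vac = 1 := by
    simp [vac_eq_occ, occ]
  have hs (u v : Idx → ℂ) (k : Fin 9) : star (ad k *ᵥ u) ⬝ᵥ v = star u ⬝ᵥ (a k *ᵥ v) := by
    rw [Matrix.star_mulVec, ad, Matrix.conjTranspose_conjTranspose, Matrix.dotProduct_mulVec]
  rw [ket, hs, a_mulVec_ket, hs, Matrix.mulVec_sub, dotProduct_sub]
  congr 1 <;> split_ifs <;> simp_all [-Matrix.mulVec_mulVec, a_mulVec_ad_mulVec, a_mulVec_vac]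

/-- The modes `i1, i2, i3`. -/
def iMode : Fin 3 → Fin 9 := ![0, 1, 2]

/-- The modes `j1, j2, j3`. -/
def jMode : Fin 3 → Fin 9 := ![3, 4, 5]

/-- The mediator modes `z, x, y`, adjacent to the modes with index `1, 2, 3` respectively. -/
def auxMode : Fin 3 → Fin 9 := ![8, 6, 7]

/-- The two-particle vector with amplitude `m r s` on `ket (f r) (g s)`. -/
def twoBody (f g : Fin 3 → Fin 9) (m : Fin 3 → Fin 3 → ℂ) : Idx → ℂ :=
  ∑ r, ∑ s, m r s • ket (f r) (g s)

lemma mulVec_twoBody (A : Mat) (f g : Fin 3 → Fin 9) (m : Fin 3 → Fin 3 → ℂ) :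
    A *ᵥ twoBody f g m = ∑ r, ∑ s, m r s • (A *ᵥ ket (f r) (g s)) := by
  simp only [twoBody, Matrix.mulVec_sum, Matrix.mulVec_smul]

lemma Vmain_mulVec_ket_iMode_jMode (r s : Fin 3) :
    Vmain *ᵥ ket (iMode r) (jMode s) =
      ket (auxMode r) (jMode s) + ket (iMode r) (auxMode s) := by
  fin_cases r <;> fin_cases s <;>
    simp [Vmain, V1, V2, Matrix.add_mulVec, hop_mulVec_ket, iMode, jMode, auxMode] <;> abel

lemma Vmain_mulVec_ket_auxMode_jMode (r s : Fin 3) :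
    Vmain *ᵥ ket (auxMode r) (jMode s) =
      ket (iMode r) (jMode s) + ket (jMode r) (jMode s) + ket (auxMode r) (auxMode s) := by
  fin_cases r <;> fin_cases s <;>
    simp [Vmain, V1, V2, Matrix.add_mulVec, hop_mulVec_ket, iMode, jMode, auxMode] <;> abel

lemma Vmain_mulVec_ket_iMode_auxMode (r s : Fin 3) :
    Vmain *ᵥ ket (iMode r) (auxMode s) =
      ket (iMode r) (jMode s) + ket (iMode r) (iMode s) + ket (auxMode r) (auxMode s) := by
  fin_cases r <;> fin_cases s <;>
    simp [Vmain, V1, V2, Matrix.add_mulVec, hop_mulVec_ket, iMode, jMode, auxMode] <;> abel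

lemma H0_mulVec_ket_auxMode_jMode (r s : Fin 3) :
    H0 *ᵥ ket (auxMode r) (jMode s) =
      ket (auxMode r) (jMode s) + ∑ t, ket (auxMode r) (jMode t) := by
  fin_cases r <;> fin_cases s <;>
    simp [H0, H0i, H0j, Matrix.add_mulVec, hop_mulVec_ket, jMode, auxMode,
      Fin.sum_univ_three] <;> abel

lemma H0_mulVec_ket_iMode_auxMode (r s : Fin 3) :
    H0 *ᵥ ket (iMode r) (auxMode s) =
      ket (iMode r) (auxMode s) + ∑ t, ket (iMode t) (auxMode s) := by
  fin_cases r <;> fin_cases s <;>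
    simp [H0, H0i, H0j, Matrix.add_mulVec, hop_mulVec_ket, iMode, auxMode,
      Fin.sum_univ_three] <;> abel

lemma Pic_mulVec_ket_iMode_jMode (r s : Fin 3) :
    Pic *ᵥ ket (iMode r) (jMode s) = ket (iMode r) (jMode s) := by
  have h : ∀ r s : Fin 3, iMode r ≠ jMode s ∧ IndepSet {iMode r, jMode s} := by decide
  rw [Pic_mulVec_ket _ _ (h r s).1, if_pos (h r s).2]

lemma Pic_mulVec_ket_auxMode_jMode (r s : Fin 3) :
    Pic *ᵥ ket (auxMode r) (jMode s) = if r = s then 0 else ket (auxMode r) (jMode s) := by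
  have h : ∀ r s : Fin 3, auxMode r ≠ jMode s ∧
      (IndepSet {auxMode r, jMode s} ↔ r ≠ s) := by decide
  rw [Pic_mulVec_ket _ _ (h r s).1]
  simp only [(h r s).2, ne_eq, ite_not]

lemma Pic_mulVec_ket_iMode_auxMode (r s : Fin 3) :
    Pic *ᵥ ket (iMode r) (auxMode s) = if r = s then 0 else ket (iMode r) (auxMode s) := by
  have h : ∀ r s : Fin 3, iMode r ≠ auxMode s ∧
      (IndepSet {iMode r, auxMode s} ↔ r ≠ s) := by decide
  rw [Pic_mulVec_ket _ _ (h r s).1]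
  simp only [(h r s).2, ne_eq, ite_not]

lemma star_twoBody_dotProduct_twoBody (f g f' g' : Fin 3 → Fin 9) (m m' : Fin 3 → Fin 3 → ℂ) :
    star (twoBody f g m) ⬝ᵥ twoBody f' g' m' =
      ∑ r, ∑ s, ∑ r', ∑ s', star (m r s) * m' r' s' *
        (star (ket (f r) (g s)) ⬝ᵥ ket (f' r') (g' s')) := by
  rw [twoBody, star_sum, sum_dotProduct]
  refine Finset.sum_congr rfl fun r _ => ?_
  rw [star_sum, sum_dotProduct]
  refine Finset.sum_congr rfl fun s _ => ?_
  simp only [twoBody, dotProduct_sum, star_smul, smul_dotProduct, dotProduct_smul, smul_eq_mul,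
    mul_assoc]
  exact Finset.sum_congr rfl fun _ _ => Finset.sum_congr rfl fun _ _ => mul_left_comm _ _ _

lemma star_twoBody_iMode_jMode_dotProduct (m m' : Fin 3 → Fin 3 → ℂ) :
    star (twoBody iMode jMode m) ⬝ᵥ twoBody iMode jMode m' =
      ∑ r, ∑ s, star (m r s) * m' r s := by
  have h : ∀ r s r' s' : Fin 3, (iMode r = iMode r' ↔ r = r') ∧ (jMode s = jMode s' ↔ s = s') ∧
      iMode r ≠ jMode s' := by decide
  simp only [star_twoBody_dotProduct_twoBody, star_ket_dotProduct_ket]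
  simp [fun r r' => (h r r r' r').1, fun s s' => (h s s s' s').2.1, fun r s => (h r r r s).2.2]

lemma star_twoBody_dotProduct_eq_zero {f g : Fin 3 → Fin 9}
    (h : ∀ r s r' s', ¬(iMode r = f r' ∧ jMode s = g s') ∧ ¬(iMode r = g s' ∧ jMode s = f r'))
    (m m' : Fin 3 → Fin 3 → ℂ) :
    star (twoBody iMode jMode m) ⬝ᵥ twoBody f g m' = 0 := by
  rw [star_twoBody_dotProduct_twoBody]
  refine Finset.sum_eq_zero fun r _ => Finset.sum_eq_zero fun s _ => Finset.sum_eq_zero fun r' _ =>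
    Finset.sum_eq_zero fun s' _ => ?_
  rw [star_ket_dotProduct_ket, ← ite_and, ← ite_and, if_neg (h r s r' s').1,
    if_neg (h r s r' s').2, sub_zero, mul_zero]

lemma Vmain_mulVec_twoBody_iMode_jMode (m : Fin 3 → Fin 3 → ℂ) :
    Vmain *ᵥ twoBody iMode jMode m = twoBody auxMode jMode m + twoBody iMode auxMode m := by
  rw [mulVec_twoBody]
  simp only [Vmain_mulVec_ket_iMode_jMode, smul_add, Finset.sum_add_distrib, twoBody]

lemma Vmain_mulVec_twoBody_auxMode_jMode (m : Fin 3 → Fin 3 → ℂ) :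
    Vmain *ᵥ twoBody auxMode jMode m =
      twoBody iMode jMode m + twoBody jMode jMode m + twoBody auxMode auxMode m := by
  rw [mulVec_twoBody]
  simp only [Vmain_mulVec_ket_auxMode_jMode, smul_add, Finset.sum_add_distrib, twoBody]

lemma Vmain_mulVec_twoBody_iMode_auxMode (m : Fin 3 → Fin 3 → ℂ) :
    Vmain *ᵥ twoBody iMode auxMode m =
      twoBody iMode jMode m + twoBody iMode iMode m + twoBody auxMode auxMode m := by
  rw [mulVec_twoBody]
  simp only [Vmain_mulVec_ket_iMode_auxMode, smul_add, Finset.sum_add_distrib, twoBody]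

lemma Pic_mulVec_twoBody_iMode_jMode (m : Fin 3 → Fin 3 → ℂ) :
    Pic *ᵥ twoBody iMode jMode m = twoBody iMode jMode m := by
  rw [mulVec_twoBody]
  simp only [Pic_mulVec_ket_iMode_jMode, twoBody]

/-- The amplitude of `ket (auxMode r) (jMode s)` in the first-order response of the product state
with amplitudes `u` on the `i` modes and `v` on the `j` modes. -/
def responseAmp (u v : Fin 3 → ℂ) (r s : Fin 3) : ℂ :=
  if r = s then 0 else u r * (v s + v r / 3)

/-- The first-order response to `Vmain` of the product state with amplitudes `u` and `v`. -/
def response (u v : Fin 3 → ℂ) : Idx → ℂ :=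
  twoBody auxMode jMode (fun r s => responseAmp u v r s) +
    twoBody iMode auxMode (fun r s => responseAmp v u s r)

lemma Pic_mulVec_response (u v : Fin 3 → ℂ) : Pic *ᵥ response u v = response u v := by
  simp only [response, Matrix.mulVec_add, mulVec_twoBody, Pic_mulVec_ket_auxMode_jMode,
    Pic_mulVec_ket_iMode_auxMode]
  simp [twoBody, Fin.sum_univ_three, responseAmp]

lemma star_twoBody_dotProduct_response (m : Fin 3 → Fin 3 → ℂ) (u v : Fin 3 → ℂ) :
    star (twoBody iMode jMode m) ⬝ᵥ response u v = 0 := by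
  rw [response, dotProduct_add, star_twoBody_dotProduct_eq_zero (by decide),
    star_twoBody_dotProduct_eq_zero (by decide), add_zero]

lemma star_twoBody_dotProduct_Vmain_twoBody (m m' : Fin 3 → Fin 3 → ℂ) :
    star (twoBody iMode jMode m) ⬝ᵥ (Vmain *ᵥ twoBody iMode jMode m') = 0 := by
  rw [Vmain_mulVec_twoBody_iMode_jMode, dotProduct_add,
    star_twoBody_dotProduct_eq_zero (by decide),
    star_twoBody_dotProduct_eq_zero (by decide), add_zero]

lemma star_twoBody_dotProduct_Vmain_response (m : Fin 3 → Fin 3 → ℂ) (u v : Fin 3 → ℂ) :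
    star (twoBody iMode jMode m) ⬝ᵥ (Vmain *ᵥ response u v) =
      ∑ r, ∑ s, star (m r s) * (responseAmp u v r s + responseAmp v u s r) := by
  simp only [response, Matrix.mulVec_add, Vmain_mulVec_twoBody_auxMode_jMode,
    Vmain_mulVec_twoBody_iMode_auxMode, dotProduct_add, star_twoBody_iMode_jMode_dotProduct]
  rw [star_twoBody_dotProduct_eq_zero (f := jMode) (by decide),
    star_twoBody_dotProduct_eq_zero (f := auxMode) (by decide),
    star_twoBody_dotProduct_eq_zero (f := iMode) (by decide),
    star_twoBody_dotProduct_eq_zero (f := auxMode) (by decide)]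
  simp only [add_zero, mul_add, Finset.sum_add_distrib]

lemma Pic_H0_mulVec_response {u v : Fin 3 → ℂ} (hu : ∑ r, u r = 0) (hv : ∑ r, v r = 0) :
    Pic *ᵥ (H0 *ᵥ response u v) =
      Pic *ᵥ (Vmain *ᵥ twoBody iMode jMode fun r s => u r * v s) := by
  rw [Fin.sum_univ_three] at hu hv
  have hu0 : u 0 = -u 1 - u 2 := by linear_combination hu
  have hv0 : v 0 = -v 1 - v 2 := by linear_combination hv
  rw [Vmain_mulVec_twoBody_iMode_jMode]
  simp only [response, Matrix.mulVec_add, mulVec_twoBody, H0_mulVec_ket_auxMode_jMode,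
    H0_mulVec_ket_iMode_auxMode, Matrix.mulVec_sum,
    Matrix.mulVec_smul, Pic_mulVec_ket_auxMode_jMode, Pic_mulVec_ket_iMode_auxMode]
  simp only [Fin.sum_univ_three, responseAmp, Fin.reduceEq, if_true, if_false, hu0, hv0]
  module

/-- The amplitudes of the encoded single-qubit state `b` on the three modes of a triangle. -/
def encAmp (b : Fin 2) : Fin 3 → ℂ :=
  if b = 0 then ![-s3 / 3, s3 / 6 + 1 / 2, s3 / 6 - 1 / 2]
  else ![-s3 / 3, s3 / 6 - 1 / 2, s3 / 6 + 1 / 2]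

lemma s3_sq : s3 ^ 2 = 3 := by
  rw [s3, ← Complex.ofReal_pow, Real.sq_sqrt (by norm_num)]; norm_num

lemma star_encAmp (b : Fin 2) (r : Fin 3) : star (encAmp b r) = encAmp b r := by
  fin_cases b <;> fin_cases r <;> simp [encAmp, s3]

lemma sum_encAmp (b : Fin 2) : ∑ r, encAmp b r = 0 := by
  fin_cases b <;> simp [encAmp, Fin.sum_univ_three] <;> ring

lemma sum_encAmp_mul (b c : Fin 2) : ∑ r, encAmp b r * encAmp c r = if b = c then 1 else 0 := by
  have h := s3_sq
  fin_cases b <;> fin_cases c <;> simp [encAmp, Fin.sum_univ_three] <;> grind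

lemma Senc_eq_sum (k : Fin 3 → Fin 9) (b : Fin 2) :
    Senc (k 0) (k 1) (k 2) b = ∑ r, encAmp b r • ad (k r) := by
  have h : s3 ≠ 0 := fun h => by simpa [h] using s3_sq
  have h3 := s3_sq
  have h0 : 1 / (2 * s3) = s3 / 6 := by field_simp; linear_combination -h3 * 2
  have h1 : s3 / 6 * (1 + s3) = s3 / 6 + 1 / 2 := by linear_combination h3 / 6
  have h2 : s3 / 6 * (1 - s3) = s3 / 6 - 1 / 2 := by linear_combination -h3 / 6
  fin_cases b <;>
    simp only [Senc, encAmp, Fin.sum_univ_three, h0, smul_add, smul_sub, smul_smul, h1, h2,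
      Fin.zero_eta, Fin.mk_one, one_ne_zero, if_true, if_false, Matrix.cons_val] <;>
    module

lemma enc_eq_twoBody (b c : Fin 2) :
    enc b c = twoBody iMode jMode fun r s => encAmp b r * encAmp c s := by
  have hi := Senc_eq_sum iMode b
  have hj := Senc_eq_sum jMode c
  simp only [iMode, jMode, Matrix.cons_val] at hi hj
  rw [enc, hi, hj, ← Matrix.mulVec_mulVec]
  simp only [Fin.sum_univ_three, Matrix.add_mulVec, Matrix.smul_mulVec, Matrix.mulVec_add,
    Matrix.mulVec_smul, twoBody, ket, iMode, jMode, Matrix.cons_val]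
  module

/-- The matrix whose columns are the first-order responses of the encoded states. -/
def responseMat : Matrix Idx (Fin 2 × Fin 2) ℂ :=
  Matrix.of fun t p => response (encAmp p.1) (encAmp p.2) t

lemma mul_Eenc_apply (A : Mat) (t : Idx) (p : Fin 2 × Fin 2) :
    (A * Eenc) t p = (A *ᵥ enc p.1 p.2) t := rfl

lemma mul_responseMat_apply (A : Mat) (t : Idx) (p : Fin 2 × Fin 2) :
    (A * responseMat) t p = (A *ᵥ response (encAmp p.1) (encAmp p.2)) t := rfl

lemma Eenc_conjTranspose_mul_apply (B : Matrix Idx (Fin 2 × Fin 2) ℂ) (p q : Fin 2 × Fin 2) :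
    (Eencᴴ * B) p q = star (enc p.1 p.2) ⬝ᵥ fun t => B t q := rfl

lemma Pic_mul_Eenc : Pic * Eenc = Eenc := by
  ext t p
  rw [mul_Eenc_apply, enc_eq_twoBody, Pic_mulVec_twoBody_iMode_jMode, ← enc_eq_twoBody]
  rfl

lemma Eenc_conjTranspose_mul_Pic : Eencᴴ * Pic = Eencᴴ := by
  have hP : Picᴴ = Pic := by
    rw [Pic, Matrix.diagonal_conjTranspose]
    congr 1
    ext t
    simp only [Pi.star_apply]
    split_ifs <;> simp
  have h := congrArg Matrix.conjTranspose Pic_mul_Eenc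
  rwa [Matrix.conjTranspose_mul, hP] at h

lemma Pic_mul_Pic : Pic * Pic = Pic := by
  rw [Pic, Matrix.diagonal_mul_diagonal]
  congr 1
  ext t
  split_ifs <;> simp

lemma Eenc_conjTranspose_mul_Eenc : Eencᴴ * Eenc = 1 := by
  ext p q
  rw [Eenc_conjTranspose_mul_apply]
  change _ ⬝ᵥ enc q.1 q.2 = _
  rw [enc_eq_twoBody, enc_eq_twoBody, star_twoBody_iMode_jMode_dotProduct]
  have h : ∀ r s, star (encAmp p.1 r * encAmp p.2 s) * (encAmp q.1 r * encAmp q.2 s) =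
      (encAmp p.1 r * encAmp q.1 r) * (encAmp p.2 s * encAmp q.2 s) := fun r s => by
    rw [star_mul', star_encAmp, star_encAmp]; ring
  simp only [h, ← Finset.mul_sum, ← Finset.sum_mul, sum_encAmp_mul, Matrix.one_apply,
    Prod.ext_iff]
  split_ifs <;> simp_all

lemma Eenc_conjTranspose_mul_Vmain_mul_Eenc : Eencᴴ * (Vmain * Eenc) = 0 := by
  ext p q
  rw [Eenc_conjTranspose_mul_apply]
  change _ ⬝ᵥ (Vmain *ᵥ enc q.1 q.2) = _
  rw [enc_eq_twoBody, enc_eq_twoBody, star_twoBody_dotProduct_Vmain_twoBody]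
  rfl

lemma Eenc_conjTranspose_mul_responseMat : Eencᴴ * responseMat = 0 := by
  ext p q
  rw [Eenc_conjTranspose_mul_apply]
  change _ ⬝ᵥ response _ _ = _
  rw [enc_eq_twoBody, star_twoBody_dotProduct_response]
  rfl

lemma Pic_mul_responseMat : Pic * responseMat = responseMat := by
  ext t p
  rw [mul_responseMat_apply, Pic_mulVec_response]
  rfl

lemma Pic_mul_H0_mul_responseMat : Pic * (H0 * responseMat) = Pic * (Vmain * Eenc) := by
  ext t p
  rw [← Matrix.mul_assoc, ← Matrix.mul_assoc, mul_responseMat_apply, mul_Eenc_apply,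
    ← Matrix.mulVec_mulVec, ← Matrix.mulVec_mulVec, enc_eq_twoBody,
    Pic_H0_mulVec_response (sum_encAmp _) (sum_encAmp _)]

lemma Eenc_conjTranspose_mul_Vmain_mul_responseMat :
    -(Eencᴴ * (Vmain * responseMat)) =
      (-(10 / 9) : ℂ) • (1 : Matrix (Fin 2 × Fin 2) (Fin 2 × Fin 2) ℂ)
        + (4 / 9 : ℂ) • (PX ⊗ₖ PX + PZ ⊗ₖ PZ) := by
  ext ⟨p₁, p₂⟩ ⟨q₁, q₂⟩
  rw [Matrix.neg_apply, Eenc_conjTranspose_mul_apply]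
  change -(_ ⬝ᵥ (Vmain *ᵥ response (encAmp q₁) (encAmp q₂))) = _
  rw [enc_eq_twoBody, star_twoBody_dotProduct_Vmain_response]
  simp only [star_mul', star_encAmp, Fin.sum_univ_three, responseAmp, Fin.reduceEq, if_true,
    if_false]
  have h := s3_sq
  fin_cases p₁ <;> fin_cases p₂ <;> fin_cases q₁ <;> fin_cases q₂ <;>
    simp [encAmp, PX, PZ] <;> grind

lemma Pip_mul_Pip : Pip * Pip = Pip := by
  have h1 : Pic * Pim = Pim := by rw [Pim, ← Matrix.mul_assoc, Pic_mul_Eenc]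
  have h2 : Pim * Pic = Pim := by rw [Pim, Matrix.mul_assoc, Eenc_conjTranspose_mul_Pic]
  have h3 : Pim * Pim = Pim := by
    rw [Pim, Matrix.mul_assoc, ← Matrix.mul_assoc Eencᴴ, Eenc_conjTranspose_mul_Eenc,
      Matrix.one_mul]
  rw [Pip, Matrix.sub_mul, Matrix.mul_sub, Matrix.mul_sub, Pic_mul_Pic, h1, h2, h3]
  abel

lemma Pip_mul_eq_Pic_mul {B : Matrix Idx (Fin 2 × Fin 2) ℂ} (h : Eencᴴ * B = 0) :
    Pip * B = Pic * B := by
  rw [Pip, Pim, Matrix.sub_mul, Matrix.mul_assoc, h, Matrix.mul_zero, sub_zero]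

/-!
STATEMENT 6: The second-order effective interaction of `V_main = V₁ + V₂` on
the encoded qubits: `−E† V_main G V_main E = −(10/9)·I₄ + (4/9)(X⊗X + Z⊗Z)`
for any `G` with `G = Π₊ G Π₊` and `G (Π_c H₀ Π_c) Π₊ = Π₊`.
-/

theorem statement6 (G : Mat) (hG : G = Pip * G * Pip)
    (hGinv : G * (Pic * H0 * Pic) * Pip = Pip) :
    -(Eencᴴ * Vmain * G * Vmain * Eenc) =
      (-(10 / 9) : ℂ) • (1 : Matrix (Fin 2 × Fin 2) (Fin 2 × Fin 2) ℂ)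
        + (4 / 9 : ℂ) • (PX ⊗ₖ PX + PZ ⊗ₖ PZ) := by
  have hPW : Pip * responseMat = responseMat := by
    rw [Pip_mul_eq_Pic_mul Eenc_conjTranspose_mul_responseMat, Pic_mul_responseMat]
  have hGP : G * Pip = G := by
    rw [hG, Matrix.mul_assoc, Pip_mul_Pip]
  have hGV : G * (Vmain * Eenc) = responseMat :=
    calc
      G * (Vmain * Eenc) = G * (Pip * (Vmain * Eenc)) := by
        rw [← Matrix.mul_assoc G Pip, hGP]
      _ = G * (Pic * (H0 * (Pic * (Pip * responseMat)))) := by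
        rw [Pip_mul_eq_Pic_mul Eenc_conjTranspose_mul_Vmain_mul_Eenc, hPW, Pic_mul_responseMat,
          Pic_mul_H0_mul_responseMat]
      _ = G * (Pic * H0 * Pic) * Pip * responseMat := by simp only [Matrix.mul_assoc]
      _ = responseMat := by rw [hGinv, hPW]
  rw [← Eenc_conjTranspose_mul_Vmain_mul_responseMat, ← hGV]
  simp only [Matrix.mul_assoc]

end
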